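/- Fix k ∈ ℕ, k ≥ 1, and let X_1, …, X_n be positive random variables with 𝔼[X_i^k] < ∞ for all i; set S := X_1 + ⋯ + X_n and assume ℙ(S > VaR_q(S)) > 0 for every q ∈ [0,1). If r^k_{q,i} = r̃^k_{q,i} for all q ∈ [0,1) and all i ∈ {1,…,n}, then for all i ≠ j in {1,…,n} and all real t > 0, 𝔼[X_i^k · e^{−tS}]/𝔼[X_i^k] = 𝔼[X_j^k · e^{−tS}]/𝔼[X_j^k] (i.e., the k-th order partially size-biased sums S^{(k)_i} and S^{(k)_j} are equal in distribution); moreover, in this case r^k_{q,i} = r̃^k_{q,i} = 𝔼[X_i^k]/𝔼[S^k]. -/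

import Mathlib

open MeasureTheory Set

/-- Value-at-Risk at level `q`: `inf {s ∈ [0,∞) : ℙ(S ≤ s) ≥ q}`. -/
noncomputable def VaR {Ω : Type*} [MeasurableSpace Ω] (μ : Measure Ω) (S : Ω → ℝ) (q : ℝ) : ℝ :=
  sInf {s : ℝ | 0 ≤ s ∧ ENNReal.ofReal q ≤ μ {ω | S ω ≤ s}}

/-- The tail event `{S > VaR_q(S)}`. -/
def tailSet {Ω : Type*} [MeasurableSpace Ω] (μ : Measure Ω) (S : Ω → ℝ) (q : ℝ) : Set Ω :=
  {ω | VaR μ S q < S ω}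

/-- CTE-based proportional allocation `r_{q,i} = 𝔼[X·1{S>s_q}]/𝔼[S·1{S>s_q}]`. -/
noncomputable def cteAlloc {Ω : Type*} [MeasurableSpace Ω] (μ : Measure Ω)
    (X S : Ω → ℝ) (q : ℝ) : ℝ :=
  (∫ ω in tailSet μ S q, X ω ∂μ) / (∫ ω in tailSet μ S q, S ω ∂μ)

/-- GTE-based proportional allocation `r̃_{q,i} = 𝔼[(X/S)·1{S>s_q}]/ℙ(S>s_q)`. -/
noncomputable def gteAlloc {Ω : Type*} [MeasurableSpace Ω] (μ : Measure Ω)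
    (X S : Ω → ℝ) (q : ℝ) : ℝ :=
  (∫ ω in tailSet μ S q, X ω / S ω ∂μ) / (μ (tailSet μ S q)).toReal

/-- `k`-th order CTE-based proportional allocation
`r^k_{q,i} = 𝔼[X^k·1{S>s_q}]/𝔼[S^k·1{S>s_q}]`. -/
noncomputable def cteAllocK {Ω : Type*} [MeasurableSpace Ω] (μ : Measure Ω)
    (X S : Ω → ℝ) (k : ℕ) (q : ℝ) : ℝ :=
  (∫ ω in tailSet μ S q, X ω ^ k ∂μ) / (∫ ω in tailSet μ S q, S ω ^ k ∂μ)

/-- `k`-th order GTE-based proportional allocation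
`r̃^k_{q,i} = 𝔼[(X/S)^k·1{S>s_q}]/ℙ(S>s_q)`. -/
noncomputable def gteAllocK {Ω : Type*} [MeasurableSpace Ω] (μ : Measure Ω)
    (X S : Ω → ℝ) (k : ℕ) (q : ℝ) : ℝ :=
  (∫ ω in tailSet μ S q, (X ω / S ω) ^ k ∂μ) / (μ (tailSet μ S q)).toReal


lemma const_of_quadratic_bound (r F : ℝ → ℝ) (K b : ℝ) (hb : 0 ≤ b)
    (h : ∀ s s', 0 ≤ s → s ≤ s' → s' ≤ b → |r s - r s'| ≤ K * (s' - s) * (F s' - F s)) :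
    r 0 = r b := by
  have key : ∀ N : ℕ, |r 0 - r b| ≤ (K * b * (F b - F 0)) / ((N : ℝ) + 1) := by
    intro N
    have hN : (0 : ℝ) < (N : ℝ) + 1 := by positivity
    have ind : ∀ j : ℕ, j ≤ N + 1 → |r 0 - r (j * (b / (N + 1)))| ≤
        K * (b / (N + 1)) * (F (j * (b / (N + 1))) - F 0) := by
      intro j
      induction j with
      | zero => intro _; simp
      | succ j ih =>
        intro hj
        have h1 := ih (by omega)
        have hd : 0 ≤ b / ((N : ℝ) + 1) := by positivity
        have hj' : ((j : ℝ) + 1) ≤ (N : ℝ) + 1 := by exact_mod_cast hj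
        have h2 := h (j * (b / (N + 1))) ((j + 1 : ℕ) * (b / (N + 1))) (by positivity)
          (by push_cast; nlinarith) (by
            push_cast
            calc ((j : ℝ) + 1) * (b / (N + 1)) ≤ ((N : ℝ) + 1) * (b / (N + 1)) := by gcongr
              _ = b := by field_simp)
        have h3 := abs_sub_le (r 0) (r (j * (b / (N + 1)))) (r ((j + 1 : ℕ) * (b / (N + 1))))
        have e : ((j + 1 : ℕ) : ℝ) * (b / (N + 1)) - j * (b / (N + 1)) = b / (N + 1) := by
          push_cast; ring
        rw [e] at h2
        linarith
    have h4 := ind (N + 1) le_rfl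
    have e : ((N + 1 : ℕ) : ℝ) * (b / (N + 1)) = b := by push_cast; field_simp
    rw [e] at h4
    refine h4.trans (le_of_eq ?_)
    ring
  have lim : Filter.Tendsto (fun N : ℕ => (K * b * (F b - F 0)) / ((N : ℝ) + 1)) Filter.atTop
      (nhds 0) := by
    simpa [div_eq_mul_inv] using
      (tendsto_one_div_add_atTop_nhds_zero_nat (𝕜 := ℝ)).const_mul (K * b * (F b - F 0))
  have := ge_of_tendsto' lim key
  have := abs_nonpos_iff.mp this
  linarith

lemma setInt_pos {Ω : Type*} [MeasurableSpace Ω] (μ : Measure Ω) 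
    (f : Ω → ℝ) (hi : Integrable f μ) (A : Set Ω) (hA : MeasurableSet A)
    (hf : ∀ ω ∈ A, 0 < f ω) (hm : 0 < μ A) : 0 < ∫ ω in A, f ω ∂μ := by
  rw [setIntegral_pos_iff_support_of_nonneg_ae _ hi.integrableOn]
  · refine hm.trans_le (measure_mono fun ω h => ⟨(hf ω h).ne', h⟩)
  · filter_upwards [ae_restrict_mem hA] with ω h using (hf ω h).le

lemma ratio_const {Ω : Type*} [MeasurableSpace Ω] (μ : Measure Ω) [IsProbabilityMeasure μ]
    (Y g : Ω → ℝ) (hY : Measurable Y) (hYi : Integrable Y μ)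
    (hg : Measurable g) (hg0 : ∀ ω, 0 ≤ g ω) (hg1 : ∀ ω, g ω ≤ 1)
    (h : ∀ v, 0 ≤ v → 0 < μ {ω | v < Y ω} →
      (∫ ω in {ω | v < Y ω}, g ω * Y ω ∂μ) / (∫ ω in {ω | v < Y ω}, Y ω ∂μ) =
      (∫ ω in {ω | v < Y ω}, g ω ∂μ) / μ.real {ω | v < Y ω})
    (b : ℝ) (hb : 0 ≤ b) (hbp : 0 < μ {ω | b < Y ω}) :
    (∫ ω in {ω | 0 < Y ω}, g ω * Y ω ∂μ) / (∫ ω in {ω | 0 < Y ω}, Y ω ∂μ) =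
    (∫ ω in {ω | b < Y ω}, g ω * Y ω ∂μ) / (∫ ω in {ω | b < Y ω}, Y ω ∂μ) := by
  have hms : ∀ v, MeasurableSet {ω | v < Y ω} := fun v => measurableSet_lt measurable_const hY
  have hgi : Integrable g μ := by
    refine Integrable.of_bound hg.aestronglyMeasurable 1 (ae_of_all _ fun ω => ?_)
    rw [Real.norm_eq_abs, abs_of_nonneg (hg0 ω)]; exact hg1 ω
  have hgYi : Integrable (fun ω => g ω * Y ω) μ := by
    refine hYi.bdd_mul hg.aestronglyMeasurable (c := 1) (ae_of_all _ fun ω => ?_)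
    rw [Real.norm_eq_abs, abs_of_nonneg (hg0 ω)]; exact hg1 ω
  set A : ℝ → ℝ := fun v => ∫ ω in {ω | v < Y ω}, g ω * Y ω ∂μ with hA
  set C : ℝ → ℝ := fun v => ∫ ω in {ω | v < Y ω}, Y ω ∂μ with hC
  set B : ℝ → ℝ := fun v => ∫ ω in {ω | v < Y ω}, g ω ∂μ with hB
  set T : ℝ → ℝ := fun v => μ.real {ω | v < Y ω} with hT
  set D : ℝ := ∫ ω in {ω | b < Y ω}, (Y ω - b) ∂μ with hD
  have hDpos : 0 < D := setInt_pos μ _ (hYi.sub (integrable_const b)) _ (hms b)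
    (fun ω hω => sub_pos.2 hω) hbp
  refine const_of_quadratic_bound (fun v => A v / C v) (fun v => - T v) (1 / D) b hb ?_
  intro s s' hs hss hsb
  have hp' : 0 < μ {ω | s' < Y ω} := hbp.trans_le (measure_mono fun ω (hω : b < Y ω) =>
    show s' < Y ω from hsb.trans_lt hω)
  have hp : 0 < μ {ω | s < Y ω} := hp'.trans_le (measure_mono fun ω (hω : s' < Y ω) =>
    show s < Y ω from hss.trans_lt hω)
  have hs' := hs.trans hss
  have Cpos : 0 < C s := setInt_pos μ _ hYi _ (hms s) (fun ω hω => hs.trans_lt hω) hp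
  have Cpos' : 0 < C s' := setInt_pos μ _ hYi _ (hms s') (fun ω hω => hs'.trans_lt hω) hp'
  have Tpos : 0 < T s := ENNReal.toReal_pos hp.ne' (measure_ne_top _ _)
  have Tpos' : 0 < T s' := ENNReal.toReal_pos hp'.ne' (measure_ne_top _ _)
  have e1 : A s / C s = B s / T s := h s hs hp
  have e1' : A s' / C s' = B s' / T s' := h s' hs' hp'
  set r := A s / C s with hr
  set r' := A s' / C s' with hr'
  have hAr : A s = r * C s := by rw [hr]; field_simp
  have hAr' : A s' = r' * C s' := by rw [hr']; field_simp
  have hBr : B s = r * T s := by rw [e1]; field_simp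
  have hBr' : B s' = r' * T s' := by rw [e1']; field_simp
  have hr0 : 0 ≤ r := by
    rw [e1]; exact div_nonneg (integral_nonneg fun ω => hg0 ω) Tpos.le
  have hr1 : r ≤ 1 := by
    rw [e1, div_le_one Tpos]
    calc B s ≤ ∫ ω in {ω | s < Y ω}, (1:ℝ) ∂μ :=
          setIntegral_mono hgi.integrableOn (integrable_const _).integrableOn hg1
      _ = T s := by simp [hT]
  -- the increment set
  set I : Set Ω := {ω | s < Y ω} \ {ω | s' < Y ω} with hI
  have hsub : {ω | s' < Y ω} ⊆ {ω | s < Y ω} := fun ω hω => lt_of_le_of_lt hss hω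
  have hIm : MeasurableSet I := (hms s).diff (hms s')
  have dA : ∫ ω in I, g ω * Y ω ∂μ = A s - A s' :=
    setIntegral_sdiff (hms s') hgYi.integrableOn hsub
  have dB : ∫ ω in I, g ω ∂μ = B s - B s' :=
    setIntegral_sdiff (hms s') hgi.integrableOn hsub
  have dC : ∫ ω in I, Y ω ∂μ = C s - C s' :=
    setIntegral_sdiff (hms s') hYi.integrableOn hsub
  have dT : μ.real I = T s - T s' := by
    rw [hI, measureReal_sdiff hsub (hms s')]
  have exp1 : ∫ ω in I, (Y ω - s') * (g ω - r) ∂μ =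
      (A s - A s') - r * (C s - C s') - s' * (B s - B s') + s' * r * (T s - T s') := by
    have : ∀ ω, (Y ω - s') * (g ω - r) = g ω * Y ω - r * Y ω - s' * g ω + s' * r := fun ω => by ring
    simp_rw [this]
    rw [integral_add, integral_sub, integral_sub, integral_const_mul, integral_const_mul, dA, dB, dC]
    · simp [dT]; ring
    · exact hgYi.integrableOn
    · exact (hYi.const_mul r).integrableOn
    · exact (hgYi.sub (hYi.const_mul r)).integrableOn
    · exact (hgi.const_mul s').integrableOn
    · exact ((hgYi.sub (hYi.const_mul r)).sub (hgi.const_mul s')).integrableOn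
    · exact (integrable_const _)
  have bound : |∫ ω in I, (Y ω - s') * (g ω - r) ∂μ| ≤ (s' - s) * (T s - T s') := by
    rw [← dT, ← Real.norm_eq_abs]
    refine norm_setIntegral_le_of_norm_le_const (measure_lt_top _ _) ?_
    intro ω hω
    have h1 : s < Y ω := hω.1
    have h2 : Y ω ≤ s' := not_lt.1 hω.2
    rw [Real.norm_eq_abs, abs_mul]
    calc |Y ω - s'| * |g ω - r| ≤ (s' - s) * 1 := by
          refine mul_le_mul ?_ ?_ (abs_nonneg _) (by linarith)
          · rw [abs_le]; constructor <;> linarith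
          · have := hg0 ω; have := hg1 ω
            rw [abs_le]; constructor <;> linarith
      _ = _ := mul_one _
  have D' : D ≤ C s' - s' * T s' := by
    have : C s' - s' * T s' = ∫ ω in {ω | s' < Y ω}, (Y ω - s') ∂μ := by
      rw [integral_sub hYi.integrableOn (integrable_const _)]
      simp [hC, hT, mul_comm]
    rw [this]
    calc D ≤ ∫ ω in {ω | b < Y ω}, (Y ω - s') ∂μ :=
          setIntegral_mono (hYi.sub (integrable_const b)).integrableOn
            (hYi.sub (integrable_const s')).integrableOn (fun ω => by simp only; linarith)
      _ ≤ _ := by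
        refine setIntegral_mono_set (hYi.sub (integrable_const s')).integrableOn ?_ ?_
        · filter_upwards [ae_restrict_mem (hms s')] with ω hω
          exact sub_nonneg.2 (le_of_lt hω)
        · exact Filter.Eventually.of_forall fun ω (hω : b < Y ω) =>
            show s' < Y ω from hsb.trans_lt hω
  have main : (r - r') * (C s' - s' * T s') = ∫ ω in I, (Y ω - s') * (g ω - r) ∂μ := by
    rw [exp1, hAr, hAr', hBr, hBr']; ring
  have h5 : |r - r'| * D ≤ (s' - s) * (T s - T s') := by
    calc |r - r'| * D ≤ |r - r'| * (C s' - s' * T s') := by gcongr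
      _ = |(r - r') * (C s' - s' * T s')| := by
        rw [abs_mul, abs_of_nonneg (hDpos.le.trans D')]
      _ ≤ _ := by rw [main]; exact bound
  have : |r - r'| ≤ (s' - s) * (T s - T s') / D := by rwa [le_div_iff₀ hDpos]
  refine this.trans (le_of_eq ?_)
  ring

lemma integral_comp_eq_of_tails {Ω : Type*} [MeasurableSpace Ω] (μ : Measure Ω)
    [IsProbabilityMeasure μ] (S f h : Ω → ℝ) (hS : Measurable S) (hf : Measurable f)
    (hh : Measurable h) (hf0 : ∀ ω, 0 ≤ f ω) (hh0 : ∀ ω, 0 ≤ h ω)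
    (hfi : Integrable f μ) (hhi : Integrable h μ)
    (H : ∀ s, ∫ ω in {ω | S ω ≤ s}, f ω ∂μ = ∫ ω in {ω | S ω ≤ s}, h ω ∂μ)
    (φ : ℝ → ℝ) (hφ : Measurable φ) :
    ∫ ω, f ω * φ (S ω) ∂μ = ∫ ω, h ω * φ (S ω) ∂μ := by
  have aux : ∀ u : Ω → ℝ, Measurable u → (∀ ω, 0 ≤ u ω) →
      ∫ x, φ x ∂(Measure.map S (μ.withDensity fun ω => ENNReal.ofReal (u ω))) =
        ∫ ω, u ω * φ (S ω) ∂μ := by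
    intro u hu hu0
    rw [integral_map hS.aemeasurable hφ.aestronglyMeasurable,
      integral_withDensity_eq_integral_toReal_smul hu.ennreal_ofReal
        (ae_of_all _ fun ω => ENNReal.ofReal_lt_top)]
    refine integral_congr_ae (ae_of_all _ fun ω => ?_)
    simp [ENNReal.toReal_ofReal (hu0 ω)]
  have aux2 : ∀ u : Ω → ℝ, Integrable u μ → (∀ ω, 0 ≤ u ω) → ∀ a,
      Measure.map S (μ.withDensity fun ω => ENNReal.ofReal (u ω)) (Iic a) =
        ENNReal.ofReal (∫ ω in {ω | S ω ≤ a}, u ω ∂μ) := by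
    intro u hu hu0 a
    have hm : MeasurableSet {ω | S ω ≤ a} := measurableSet_le hS measurable_const
    rw [Measure.map_apply hS measurableSet_Iic]
    change (μ.withDensity _) {ω | S ω ≤ a} = _
    rw [withDensity_apply _ hm, ofReal_integral_eq_lintegral_ofReal hu.integrableOn
      (ae_of_all _ hu0)]
  have : IsFiniteMeasure (μ.withDensity fun ω => ENNReal.ofReal (f ω)) :=
    isFiniteMeasure_withDensity_ofReal hfi.2
  rw [← aux f hf hf0, ← aux h hh hh0]
  congr 1
  refine Measure.ext_of_Iic _ _ fun a => ?_
  rw [aux2 f hfi hf0, aux2 h hhi hh0, H]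

lemma VaR_nonneg' {Ω : Type*} [MeasurableSpace Ω] (μ : Measure Ω) (S : Ω → ℝ) (q : ℝ) :
    0 ≤ VaR μ S q := Real.sInf_nonneg fun _ h => h.1

lemma exists_tailSet_ae_eq {Ω : Type*} [MeasurableSpace Ω] (μ : Measure Ω)
    [IsProbabilityMeasure μ] (S : Ω → ℝ) (hS : Measurable S) (s : ℝ) (hs : 0 ≤ s)
    (hp : 0 < μ {ω | s < S ω}) :
    ∃ q ∈ Ico (0 : ℝ) 1, tailSet μ S q =ᵐ[μ] {ω | s < S ω} := by
  have hm : ∀ a, MeasurableSet {ω | S ω ≤ a} := fun a => measurableSet_le hS measurable_const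
  have hq : ENNReal.ofReal (μ.real {ω | S ω ≤ s}) = μ {ω | S ω ≤ s} :=
    ENNReal.ofReal_toReal (measure_ne_top _ _)
  refine ⟨μ.real {ω | S ω ≤ s}, ⟨measureReal_nonneg, ?_⟩, ?_⟩
  · have h1 := probReal_compl_eq_one_sub (μ := μ) (hm s)
    have h2 : {ω | S ω ≤ s}ᶜ = {ω | s < S ω} := by ext; simp
    rw [h2] at h1
    have : 0 < μ.real {ω | s < S ω} := ENNReal.toReal_pos hp.ne' (measure_ne_top _ _)
    linarith
  set q := μ.real {ω | S ω ≤ s}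
  set V : Set ℝ := {s' : ℝ | 0 ≤ s' ∧ ENNReal.ofReal q ≤ μ {ω | S ω ≤ s'}} with hV
  have hbdd : BddBelow V := ⟨0, fun _ h => h.1⟩
  have hsV : s ∈ V := ⟨hs, hq.le⟩
  have hle : VaR μ S q ≤ s := csInf_le hbdd hsV
  have hsub : {ω | s < S ω} ⊆ tailSet μ S q := fun ω hω => hle.trans_lt hω
  have null : ∀ m : ℕ, μ {ω | VaR μ S q + 1 / ((m : ℝ) + 1) < S ω ∧ S ω ≤ s} = 0 := by
    intro m
    have hmp : (0 : ℝ) < 1 / ((m : ℝ) + 1) := by positivity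
    obtain ⟨s', hs'V, hs'⟩ := exists_lt_of_csInf_lt ⟨s, hsV⟩
      (show sInf V < VaR μ S q + 1 / ((m : ℝ) + 1) from lt_add_of_pos_right _ hmp)
    by_cases hc : s' ≤ s
    · refine measure_mono_null (t := {ω | S ω ≤ s} \ {ω | S ω ≤ s'})
        (fun ω hω => ⟨hω.2, not_le.2 (hs'.trans hω.1)⟩) ?_
      rw [measure_sdiff (show {ω | S ω ≤ s'} ⊆ {ω | S ω ≤ s} from
          fun ω (hω : S ω ≤ s') => hω.trans hc) (hm s').nullMeasurableSet
        (measure_ne_top _ _), ← hq]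
      exact tsub_eq_zero_of_le hs'V.2
    · convert measure_empty (μ := μ)
      ext ω
      simp only [mem_ofPred_eq, mem_empty_iff_false, iff_false, not_and]
      intro h1 h2
      linarith
  have hU := measure_iUnion_null null
  refine (Filter.EventuallyLE.antisymm ?_ hsub.eventuallyLE)
  rw [ae_le_set]
  refine measure_mono_null ?_ hU
  intro ω hω
  have h1 : VaR μ S q < S ω := hω.1
  have h2 : S ω ≤ s := not_lt.1 hω.2
  obtain ⟨m, hm'⟩ := exists_nat_one_div_lt (sub_pos.2 h1)
  exact mem_iUnion.2 ⟨m, by linarith, h2⟩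

/-- Key fact: the truncated moments are proportional. -/
lemma key_prop {Ω : Type*} [MeasurableSpace Ω] (μ : Measure Ω) [IsProbabilityMeasure μ]
    (k : ℕ) (hk : 1 ≤ k) (X S : Ω → ℝ) (hX : Measurable X) (hSm : Measurable S)
    (hX0 : ∀ ω, 0 < X ω) (hXS : ∀ ω, X ω ≤ S ω) (hSi : Integrable (fun ω => S ω ^ k) μ)
    (hW : ∀ q ∈ Set.Ico (0 : ℝ) 1, cteAllocK μ X S k q = gteAllocK μ X S k q)
    (s : ℝ) (hs : 0 ≤ s) :
    ∫ ω in {ω | s < S ω}, X ω ^ k ∂μ =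
      (∫ ω, X ω ^ k ∂μ) / (∫ ω, S ω ^ k ∂μ) * ∫ ω in {ω | s < S ω}, S ω ^ k ∂μ := by
  have hk0 : k ≠ 0 := by omega
  have hS0 : ∀ ω, 0 < S ω := fun ω => (hX0 ω).trans_le (hXS ω)
  by_cases hp : μ {ω | s < S ω} = 0
  · rw [Measure.restrict_eq_zero.2 hp]; simp
  replace hp : 0 < μ {ω | s < S ω} := pos_iff_ne_zero.2 hp
  have hgY : ∀ ω, (X ω / S ω) ^ k * S ω ^ k = X ω ^ k := fun ω => by
    rw [div_pow, div_mul_cancel₀ _ (pow_pos (hS0 ω) k).ne']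
  have sets : ∀ a, 0 ≤ a → {ω | a ^ k < S ω ^ k} = {ω | a < S ω} := fun a ha => by
    ext ω; exact pow_lt_pow_iff_left₀ ha (hS0 ω).le hk0
  have main := ratio_const μ (fun ω => S ω ^ k) (fun ω => (X ω / S ω) ^ k) (hSm.pow_const k) hSi
    ((hX.div hSm).pow_const k) (fun ω => pow_nonneg (div_nonneg (hX0 ω).le (hS0 ω).le) k)
    (fun ω => pow_le_one₀ (div_nonneg (hX0 ω).le (hS0 ω).le)
      ((div_le_one (hS0 ω)).2 (hXS ω))) ?_ (s ^ k) (pow_nonneg hs k) (by rwa [sets s hs])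
  · simp only [hgY] at main
    rw [sets s hs] at main
    have h0 : {ω | 0 < S ω ^ k} = univ := by
      ext ω; simpa using pow_pos (hS0 ω) k
    rw [h0, Measure.restrict_univ] at main
    have hpos : 0 < ∫ ω in {ω | s < S ω}, S ω ^ k ∂μ :=
      setInt_pos μ _ hSi _ (measurableSet_lt measurable_const hSm)
        (fun ω _ => pow_pos (hS0 ω) k) hp
    rw [main]; field_simp
  · intro v hv hvp
    obtain ⟨a, ha, rfl⟩ : ∃ a : ℝ, 0 ≤ a ∧ a ^ k = v :=
      ⟨v ^ ((k : ℝ)⁻¹), Real.rpow_nonneg hv _, Real.rpow_inv_natCast_pow hv hk0⟩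
    simp only [hgY]
    rw [sets a ha] at hvp ⊢
    obtain ⟨q, hq, hqe⟩ := exists_tailSet_ae_eq μ S hSm a ha hvp
    have := hW q hq
    simp only [cteAllocK, gteAllocK] at this
    rw [setIntegral_congr_set hqe, setIntegral_congr_set hqe, setIntegral_congr_set hqe,
      measure_congr hqe] at this
    exact this

/-- If the `k`-th order CTE- and GTE-based allocations agree at every level, then all `k`-th
order partially size-biased sums have the same Laplace transform, and the common allocation
value equals `𝔼[X_i^k]/𝔼[S^k]`. -/
theorem kth_order_mem_W_implies_laplace
    {Ω : Type*} [MeasurableSpace Ω] (μ : Measure Ω) [IsProbabilityMeasure μ]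
    (k : ℕ) (hk : 1 ≤ k)
    (n : ℕ) (X : Fin n → Ω → ℝ)
    (hmeas : ∀ i, Measurable (X i)) (hpos : ∀ i ω, 0 < X i ω)
    (hint : ∀ i, Integrable (fun ω => X i ω ^ k) μ)
    (S : Ω → ℝ) (hS : S = fun ω => ∑ i, X i ω)
    (hP : ∀ q ∈ Set.Ico (0 : ℝ) 1, 0 < μ (tailSet μ S q))
    (hW : ∀ q ∈ Set.Ico (0 : ℝ) 1, ∀ i, cteAllocK μ (X i) S k q = gteAllocK μ (X i) S k q) :
    (∀ i j, i ≠ j → ∀ t : ℝ, 0 < t →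
        (∫ ω, X i ω ^ k * Real.exp (-t * S ω) ∂μ) / (∫ ω, X i ω ^ k ∂μ) =
          (∫ ω, X j ω ^ k * Real.exp (-t * S ω) ∂μ) / (∫ ω, X j ω ^ k ∂μ)) ∧
      (∀ q ∈ Set.Ico (0 : ℝ) 1, ∀ i,
        cteAllocK μ (X i) S k q = (∫ ω, X i ω ^ k ∂μ) / (∫ ω, S ω ^ k ∂μ) ∧
          gteAllocK μ (X i) S k q = (∫ ω, X i ω ^ k ∂μ) / (∫ ω, S ω ^ k ∂μ)) := by
  have hXS : ∀ i ω, X i ω ≤ S ω := fun i ω => by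
    rw [hS]
    exact Finset.single_le_sum (f := fun i => X i ω) (fun j _ => (hpos j ω).le) (Finset.mem_univ i)
  have hSm : Measurable S := by
    rw [hS]; exact Finset.measurable_sum _ fun i _ => hmeas i
  have hk0 : k ≠ 0 := by omega
  have hSi : Integrable (fun ω => S ω ^ k) μ := by
    have hL : ∀ i, MemLp (X i) k μ := fun i => by
      rw [← integrable_norm_rpow_iff (hmeas i).aestronglyMeasurable (by exact_mod_cast hk0)
        (ENNReal.natCast_ne_top k)]
      refine (hint i).congr (ae_of_all _ fun ω => ?_)
      simp [abs_of_pos (hpos i ω)]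
    have hSL : MemLp S k μ := by
      rw [hS]; exact memLp_finsetSum _ fun i _ => hL i
    have := hSL.integrable_norm_pow hk0
    refine this.congr (ae_of_all _ fun ω => ?_)
    have : 0 ≤ S ω := by rw [hS]; exact Finset.sum_nonneg fun j _ => (hpos j ω).le
    simp [abs_of_nonneg this]
  have key := fun i => key_prop μ k hk (X i) S (hmeas i) hSm (hpos i) (hXS i) hSi
    (fun q hq => hW q hq i)
  have hXpos : ∀ i, 0 < ∫ ω, X i ω ^ k ∂μ := fun i => by
    have := setInt_pos μ _ (hint i) univ MeasurableSet.univ (fun ω _ => pow_pos (hpos i ω) k)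
      (by simp)
    simpa using this
  have hSpos : Fin n → 0 < ∫ ω, S ω ^ k ∂μ := fun i =>
    (hXpos i).trans_le (integral_mono (hint i) hSi fun ω =>
      pow_le_pow_left₀ (hpos i ω).le (hXS i ω) k)
  constructor
  · have lap : ∀ i, ∀ t : ℝ, 0 < t →
        (∫ ω, X i ω ^ k * Real.exp (-t * S ω) ∂μ) / (∫ ω, X i ω ^ k ∂μ) =
          (∫ ω, S ω ^ k * Real.exp (-t * S ω) ∂μ) / (∫ ω, S ω ^ k ∂μ) := by
      intro i t ht
      have hS0 : ∀ ω, 0 < S ω := fun ω => (hpos i ω).trans_le (hXS i ω)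
      set c := (∫ ω, X i ω ^ k ∂μ) / (∫ ω, S ω ^ k ∂μ) with hc
      have hc0 : 0 < c := div_pos (hXpos i) (hSpos i)
      have hcm : ∫ ω, X i ω ^ k ∂μ = c * ∫ ω, S ω ^ k ∂μ := by
        rw [hc, div_mul_cancel₀ _ (hSpos i).ne']
      have e := integral_comp_eq_of_tails μ S (fun ω => X i ω ^ k) (fun ω => c * S ω ^ k) hSm
        ((hmeas i).pow_const k) ((hSm.pow_const k).const_mul c)
        (fun ω => pow_nonneg (hpos i ω).le k)
        (fun ω => mul_nonneg hc0.le (pow_nonneg (hS0 ω).le k)) (hint i) (hSi.const_mul c) ?_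
        (fun x => Real.exp (-t * x)) (by fun_prop)
      · simp only [mul_assoc] at e
        rw [integral_const_mul] at e
        rw [e, hcm, mul_div_mul_left _ _ hc0.ne']
      · intro s
        rw [integral_const_mul]
        by_cases hs : 0 ≤ s
        · have hm : MeasurableSet {ω | S ω ≤ s} := measurableSet_le hSm measurable_const
          have h2 : {ω | S ω ≤ s}ᶜ = {ω | s < S ω} := by ext; simp
          have a1 := integral_add_compl hm (hint i)
          have a2 := integral_add_compl hm hSi
          have a3 := key i s hs
          rw [h2] at a1 a2
          rw [← hc] at a3
          rw [← a2] at hcm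
          linarith
        · have h2 : {ω | S ω ≤ s} = ∅ := by
            ext ω; simp only [mem_ofPred_eq, mem_empty_iff_false, iff_false, not_le]
            linarith [hS0 ω]
          simp [h2]
    intro i j _ t ht
    rw [lap i t ht, lap j t ht]
  · intro q hq i
    have h1 : cteAllocK μ (X i) S k q = (∫ ω, X i ω ^ k ∂μ) / (∫ ω, S ω ^ k ∂μ) := by
      have a := key i (VaR μ S q) (VaR_nonneg' μ S q)
      have hp : 0 < ∫ ω in tailSet μ S q, S ω ^ k ∂μ :=
        setInt_pos μ _ hSi _ (measurableSet_lt measurable_const hSm)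
          (fun ω _ => pow_pos ((hpos i ω).trans_le (hXS i ω)) k) (hP q hq)
      rw [cteAllocK, div_eq_iff hp.ne']
      exact a
    exact ⟨h1, (hW q hq i) ▸ h1⟩
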